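/- arXiv:1912.08599 — 3 statements merged into one kernel-verified Lean document; each statement's English description precedes it below -/
import Mathlib

section
/- Let t0 < T be real numbers, θ ∈ (0,1), γ > 0, b > 0, x0 ∈ ℝ, and let f : [t0,T] × ℝ → ℝ be continuous and satisfy |f(t,y1) − f(t,y2)| ≤ A|y1 − y2| for all t ∈ [t0,T] and y1, y2 ∈ ℝ, where A > 0. Define, for continuous x : [t0,T] → ℝ, (Υx)(t) = x0 + ((1−θ)/b) f(t, x(t)) + Σ_{i=1}^∞ C(γ,i) θ^i / (b (1−θ)^{i−1} Γ(iθ)) ∫_{t0}^t (t−s)^{iθ−1} f(s, x(s)) ds. If f(t0, x0) = 0 and C2(T,A) = (A/b)[(1−θ) + Σ_{i=1}^∞ |C(γ,i)| θ^i (T−t0)^{iθ} / ((1−θ)^{i−1} Γ(iθ+1))] < 1, then there exists a unique continuous function x : [t0,T] → ℝ with x(t) = (Υx)(t) for all t ∈ [t0,T]; in particular x(t0) = x0. -/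
open Real MeasureTheory Set

/-- Generalized binomial coefficient `C(γ, i) = γ(γ-1)⋯(γ-i+1)/i!`. -/
noncomputable def genBinom (γ : ℝ) (i : ℕ) : ℝ :=
  (∏ j ∈ Finset.range i, (γ - j)) / (Nat.factorial i : ℝ)

/-- Rising factorial `(ρ)_k = ρ(ρ+1)⋯(ρ+k-1)`. -/
noncomputable def risingFac (ρ : ℝ) (k : ℕ) : ℝ :=
  ∏ j ∈ Finset.range k, (ρ + j)

/-- Generalized Mittag-Leffler function `E_{θ,β}^ρ(λ, z)`
(terms with `Γ` at a pole vanish since `Real.Gamma` is `0` there). -/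
noncomputable def mittagLeffler (θ β ρ lam z : ℝ) : ℝ :=
  ∑' k : ℕ, lam ^ k * z ^ ((k : ℝ) * θ + β - 1) * risingFac ρ k /
    (Real.Gamma ((k : ℝ) * θ + β) * (Nat.factorial k : ℝ))

/-- Generalized AB fractional integral `(I^{θ,μ,γ} η)(t)` starting at `t0`,
with normalization constant `b = B(θ) > 0`. -/
noncomputable def ABIntegral (t0 b θ μ γ : ℝ) (η : ℝ → ℝ) (t : ℝ) : ℝ :=
  ∑' i : ℕ, genBinom γ i * θ ^ i /
      (b * (1 - θ) ^ ((i : ℝ) - 1) * Real.Gamma ((i : ℝ) * θ + 1 - μ)) *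
    ∫ s in t0..t, (t - s) ^ ((i : ℝ) * θ - μ) * η s

/-- Generalized ABC fractional derivative `(D^{θ,μ,γ} f)(t)` starting at `t0`,
with `λ = -θ/(1-θ)` and normalization constant `b = B(θ) > 0`. -/
noncomputable def ABCDeriv (t0 b θ μ γ : ℝ) (f : ℝ → ℝ) (t : ℝ) : ℝ :=
  (b / (1 - θ)) * ∫ s in t0..t, mittagLeffler θ μ γ (-θ / (1 - θ)) (t - s) * deriv f s

/-- Generalized ABR fractional derivative `(R^{θ,μ,γ} f)(t)` starting at `t0`. -/
noncomputable def ABRDeriv (t0 b θ μ γ : ℝ) (f : ℝ → ℝ) (t : ℝ) : ℝ :=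
  (b / (1 - θ)) *
    deriv (fun u => ∫ s in t0..u, mittagLeffler θ μ γ (-θ / (1 - θ)) (u - s) * f s) t

/-- The contraction constant `C1(T, A)` (case `μ ≠ 1`). -/
noncomputable def C1const (t0 T b θ μ γ A : ℝ) : ℝ :=
  (A / b) * ∑' i : ℕ, |genBinom γ i| * θ ^ i * (T - t0) ^ ((i : ℝ) * θ + 1 - μ) /
    ((1 - θ) ^ ((i : ℝ) - 1) * Real.Gamma ((i : ℝ) * θ + 2 - μ))

/-- The contraction constant `C2(T, A)` (case `μ = 1`). -/
noncomputable def C2const (t0 T b θ γ A : ℝ) : ℝ :=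
  (A / b) * ((1 - θ) +
    ∑' i : ℕ, |genBinom γ (i + 1)| * θ ^ (i + 1) * (T - t0) ^ (((i : ℝ) + 1) * θ) /
      ((1 - θ) ^ (i : ℕ) * Real.Gamma (((i : ℝ) + 1) * θ + 1)))

/-- The operator `Υ` in the case `μ = 1`, whose `i = 0` term reduces to `((1-θ)/b) f(t, x(t))`. -/
noncomputable def UpsilonMuOne (t0 b θ γ x0 : ℝ) (f : ℝ → ℝ → ℝ) (x : ℝ → ℝ) (t : ℝ) : ℝ :=
  x0 + ((1 - θ) / b) * f t (x t) +
    ∑' i : ℕ, genBinom γ (i + 1) * θ ^ (i + 1) /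
        (b * (1 - θ) ^ (i : ℕ) * Real.Gamma (((i : ℝ) + 1) * θ)) *
      ∫ s in t0..t, (t - s) ^ (((i : ℝ) + 1) * θ - 1) * f s (x s)

lemma rpow_mul_exp_neg_le_Gamma {R x : ℝ} (hR : 0 < R) (hx : 0 ≤ x) :
    R ^ x * Real.exp (-R) ≤ Real.Gamma (x + 1) := by
  have h_int : IntegrableOn (fun t : ℝ => Real.exp (-t) * t ^ (x + 1 - 1)) (Ioi 0) :=
    Real.GammaIntegral_convergent (by linarith)
  rw [Real.Gamma_eq_integral (by linarith), ← integral_exp_neg_Ioi R, ← integral_const_mul]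
  calc ∫ t in Ioi R, R ^ x * Real.exp (-t)
      ≤ ∫ t in Ioi R, Real.exp (-t) * t ^ (x + 1 - 1) := by
        refine setIntegral_mono_on ?_ (h_int.mono_set (Ioi_subset_Ioi hR.le)) measurableSet_Ioi ?_
        · exact (integrableOn_exp_neg_Ioi R).const_mul _
        · intro t ht
          rw [mul_comm, add_sub_cancel_right]
          gcongr
          exact (mem_Ioi.1 ht).le
    _ ≤ ∫ t in Ioi (0 : ℝ), Real.exp (-t) * t ^ (x + 1 - 1) := by
        refine setIntegral_mono_set h_int ?_ (Ioi_subset_Ioi hR.le).eventuallyLE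
        filter_upwards [ae_restrict_mem measurableSet_Ioi] with t ht
        have := mem_Ioi.1 ht
        positivity

/-- The Mittag-Leffler series converges everywhere. -/
lemma summable_pow_div_Gamma {θ K : ℝ} (hθ : 0 < θ) (hK : 0 < K) :
    Summable fun n : ℕ => K ^ n / Real.Gamma ((n : ℝ) * θ + 1) := by
  set R : ℝ := (2 * K) ^ θ⁻¹
  have hR : 0 < R := by positivity
  have hRθ : R ^ θ = 2 * K := Real.rpow_inv_rpow (by positivity) hθ.ne'
  refine Summable.of_nonneg_of_le (fun n => ?_) (fun n => ?_)
    ((summable_geometric_two).mul_left (Real.exp R))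
  · have : 0 < Real.Gamma ((n : ℝ) * θ + 1) := Real.Gamma_pos_of_pos (by positivity)
    positivity
  · have h := rpow_mul_exp_neg_le_Gamma hR (show 0 ≤ (n : ℝ) * θ by positivity)
    have hpow : R ^ ((n : ℝ) * θ) = (2 * K) ^ n := by
      rw [mul_comm, Real.rpow_mul hR.le, hRθ, Real.rpow_natCast]
    rw [hpow] at h
    calc K ^ n / Real.Gamma ((n : ℝ) * θ + 1)
        ≤ K ^ n / ((2 * K) ^ n * Real.exp (-R)) := by gcongr
      _ = Real.exp R * (1 / 2) ^ n := by
        rw [Real.exp_neg, mul_pow, div_pow, one_pow]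
        field_simp

lemma abs_genBinom_le {γ : ℝ} (hγ : 0 < γ) (i : ℕ) : |genBinom γ i| ≤ (1 + γ) ^ i := by
  rw [genBinom, abs_div, Nat.abs_cast, div_le_iff₀ (by positivity), Finset.abs_prod,
    ← Finset.prod_range_add_one_eq_factorial, Nat.cast_prod]
  calc ∏ j ∈ Finset.range i, |γ - j|
      ≤ ∏ j ∈ Finset.range i, ((1 + γ) * ((j + 1 : ℕ) : ℝ)) := by
        refine Finset.prod_le_prod (fun _ _ => abs_nonneg _) fun j _ => ?_
        have hj : (0 : ℝ) ≤ j := by positivity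
        push_cast
        rw [abs_le]
        constructor <;> nlinarith [mul_nonneg hγ.le hj]
    _ = (1 + γ) ^ i * ∏ j ∈ Finset.range i, ((j + 1 : ℕ) : ℝ) := by
        rw [Finset.prod_mul_distrib, Finset.prod_const, Finset.card_range]

lemma summable_C2const_terms {θ γ L : ℝ} (hθ0 : 0 < θ) (hθ1 : θ < 1) (hγ : 0 < γ) (hL : 0 < L) :
    Summable fun i : ℕ => |genBinom γ (i + 1)| * θ ^ (i + 1) * L ^ (((i : ℝ) + 1) * θ) /
      ((1 - θ) ^ i * Real.Gamma (((i : ℝ) + 1) * θ + 1)) := by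
  have h1 : 0 < 1 - θ := by linarith
  set K : ℝ := (1 + γ) * θ * L ^ θ / (1 - θ) with hK
  have hKpos : 0 < K := by positivity
  have hs := ((summable_nat_add_iff 1).2 (summable_pow_div_Gamma hθ0 hKpos)).mul_left (1 - θ)
  refine Summable.of_nonneg_of_le (fun i => ?_) (fun i => ?_) hs
  · have : 0 < Real.Gamma (((i : ℝ) + 1) * θ + 1) := Real.Gamma_pos_of_pos (by positivity)
    positivity
  · have hG : 0 < Real.Gamma (((i : ℝ) + 1) * θ + 1) := Real.Gamma_pos_of_pos (by positivity)
    have hpow : L ^ (((i : ℝ) + 1) * θ) = (L ^ θ) ^ (i + 1) := by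
      rw [mul_comm, Real.rpow_mul hL.le, ← Nat.cast_add_one, Real.rpow_natCast]
    rw [hpow]
    push_cast
    calc _ ≤ (1 + γ) ^ (i + 1) * θ ^ (i + 1) * (L ^ θ) ^ (i + 1) /
          ((1 - θ) ^ i * Real.Gamma (((i : ℝ) + 1) * θ + 1)) := by
          gcongr
          exact abs_genBinom_le hγ _
      _ = _ := by
          rw [hK, div_pow, mul_pow, mul_pow, pow_succ (1 - θ) i]
          field_simp

lemma intervalIntegrable_sub_rpow_mul {t0 t α : ℝ} (hα : 0 < α) (ht : t0 ≤ t) {g : ℝ → ℝ}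
    (hg : ContinuousOn g (Icc t0 t)) :
    IntervalIntegrable (fun s => (t - s) ^ (α - 1) * g s) volume t0 t := by
  have h := (intervalIntegral.intervalIntegrable_rpow' (a := t - t0) (b := 0)
    (show -1 < α - 1 by linarith)).comp_sub_left t
  rw [sub_sub_cancel, sub_zero] at h
  exact h.mul_continuousOn (by rwa [uIcc_of_le ht])

lemma integral_sub_rpow_mul_eq {t0 t α : ℝ} (hα : 0 < α) (ht : t0 ≤ t) (g : ℝ → ℝ) :
    ∫ s in t0..t, (t - s) ^ (α - 1) * g s =
      (t - t0) ^ α * ∫ v in (0 : ℝ)..1, v ^ (α - 1) * g (t - (t - t0) * v) := by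
  rcases ht.eq_or_lt with rfl | ht
  · simp [Real.zero_rpow hα.ne']
  have hd : 0 < t - t0 := by linarith
  have h := intervalIntegral.smul_integral_comp_sub_mul (a := 0) (b := 1)
    (fun s => (t - s) ^ (α - 1) * g s) (t - t0) t
  simp only [mul_one, mul_zero, sub_zero, sub_sub_cancel, smul_eq_mul] at h
  rw [← h]
  have hα' : (t - t0) ^ α = (t - t0) * (t - t0) ^ (α - 1) := by
    rw [← Real.rpow_one_add' hd.le (by simpa using hα.ne')]
    congr 1
    ring
  rw [hα', mul_assoc, ← intervalIntegral.integral_const_mul ((t - t0) ^ (α - 1))]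
  refine congrArg _ (intervalIntegral.integral_congr fun v hv => ?_)
  rw [uIcc_of_le zero_le_one] at hv
  simp only [Real.mul_rpow hd.le hv.1, mul_assoc]

lemma abs_integral_sub_rpow_mul_le {t0 t α M : ℝ} (hα : 0 < α) (ht : t0 ≤ t) {g : ℝ → ℝ}
    (hM : ∀ s ∈ Icc t0 t, |g s| ≤ M) :
    |∫ s in t0..t, (t - s) ^ (α - 1) * g s| ≤ (t - t0) ^ α / α * M := by
  rw [integral_sub_rpow_mul_eq hα ht, abs_mul, abs_of_nonneg (Real.rpow_nonneg (by linarith) _),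
    div_mul_eq_mul_div, mul_div_assoc]
  refine mul_le_mul_of_nonneg_left ?_ (Real.rpow_nonneg (by linarith) _)
  have h_int : IntervalIntegrable (fun v : ℝ => v ^ (α - 1) * M) volume 0 1 :=
    (intervalIntegral.intervalIntegrable_rpow' (by linarith)).mul_const M
  have hval : ∫ v in (0 : ℝ)..1, v ^ (α - 1) * M = M / α := by
    rw [intervalIntegral.integral_mul_const, integral_rpow (Or.inl (by linarith))]
    simp [Real.zero_rpow hα.ne']
    ring
  rw [← hval, ← Real.norm_eq_abs]
  refine intervalIntegral.norm_integral_le_of_norm_le zero_le_one ?_ h_int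
  refine Filter.Eventually.of_forall fun v hv => ?_
  rw [norm_mul, Real.norm_of_nonneg (Real.rpow_nonneg hv.1.le _)]
  refine mul_le_mul_of_nonneg_left (hM _ ?_) (Real.rpow_nonneg hv.1.le _)
  constructor <;> nlinarith [hv.1, hv.2]

lemma continuousOn_integral_sub_rpow_mul {t0 T α : ℝ} (hα : 0 < α) (htT : t0 ≤ T) {g : ℝ → ℝ}
    (hg : ContinuousOn g (Icc t0 T)) :
    ContinuousOn (fun t => ∫ s in t0..t, (t - s) ^ (α - 1) * g s) (Icc t0 T) := by
  set G : ℝ → ℝ := IccExtend htT ((Icc t0 T).domRestrict g) with hG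
  have hGc : Continuous G := hg.domRestrict.Icc_extend'
  have hGg : ∀ s ∈ Icc t0 T, G s = g s := fun s hs => by
    rw [hG, IccExtend_of_mem _ _ hs, domRestrict_apply]
  obtain ⟨M, hM⟩ := isCompact_Icc.exists_bound_of_continuousOn hg
  have hGM : ∀ s, ‖G s‖ ≤ M := fun s => hM _ (projIcc t0 T htT s).2
  have hcont : Continuous fun t : ℝ =>
      ∫ v in (0 : ℝ)..1, v ^ (α - 1) * G (t - (t - t0) * v) := by
    refine intervalIntegral.continuous_of_dominated_interval
      (bound := fun v => v ^ (α - 1) * M) (fun t => ?_) (fun t => ?_)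
      ((intervalIntegral.intervalIntegrable_rpow' (by linarith)).mul_const M) ?_
    · refine Measurable.aestronglyMeasurable ?_
      exact (measurable_id.pow_const _).mul
        (hGc.comp (by fun_prop : Continuous fun v : ℝ => t - (t - t0) * v)).measurable
    · refine Filter.Eventually.of_forall fun v hv => ?_
      rw [uIoc_of_le zero_le_one] at hv
      rw [norm_mul, Real.norm_of_nonneg (Real.rpow_nonneg hv.1.le _)]
      exact mul_le_mul_of_nonneg_left (hGM _) (Real.rpow_nonneg hv.1.le _)
    · exact Filter.Eventually.of_forall fun v _ => by fun_prop
  have hpow : Continuous fun t : ℝ => (t - t0) ^ α :=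
    (continuous_id.sub continuous_const).rpow_const fun _ => Or.inr hα.le
  refine (hpow.mul hcont).continuousOn.congr fun t ht => ?_
  refine Eq.trans ?_ (integral_sub_rpow_mul_eq hα ht.1 G)
  refine intervalIntegral.integral_congr fun s hs => ?_
  rw [uIcc_of_le ht.1] at hs
  simp only [hGg s ⟨hs.1, hs.2.trans ht.2⟩]

/-- The `i`-th summand (shifted by one) of the series in `UpsilonMuOne`, applied to `g`. -/
noncomputable def fracTerm (t0 b θ γ : ℝ) (g : ℝ → ℝ) (i : ℕ) (t : ℝ) : ℝ :=
  genBinom γ (i + 1) * θ ^ (i + 1) /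
      (b * (1 - θ) ^ (i : ℕ) * Real.Gamma (((i : ℝ) + 1) * θ)) *
    ∫ s in t0..t, (t - s) ^ (((i : ℝ) + 1) * θ - 1) * g s

lemma abs_fracTerm_le {t0 T b θ γ t M : ℝ} (hθ0 : 0 < θ) (hθ1 : θ < 1) (hb : 0 < b)
    (ht : t ∈ Icc t0 T) {g : ℝ → ℝ} (hM : ∀ s ∈ Icc t0 t, |g s| ≤ M) (i : ℕ) :
    |fracTerm t0 b θ γ g i t| ≤ |genBinom γ (i + 1)| * θ ^ (i + 1) *
      (T - t0) ^ (((i : ℝ) + 1) * θ) / ((1 - θ) ^ i * Real.Gamma (((i : ℝ) + 1) * θ + 1)) *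
        (M / b) := by
  have h1 : 0 < 1 - θ := by linarith
  have hα : 0 < ((i : ℝ) + 1) * θ := by positivity
  have hΓ : 0 < Real.Gamma (((i : ℝ) + 1) * θ) := Real.Gamma_pos_of_pos hα
  have hM0 : 0 ≤ M := (abs_nonneg _).trans (hM t ⟨ht.1, le_rfl⟩)
  have hd : 0 ≤ t - t0 := sub_nonneg.2 ht.1
  have h_int := abs_integral_sub_rpow_mul_le hα ht.1 hM
  rw [fracTerm, abs_mul, abs_div, abs_mul, abs_of_pos (pow_pos hθ0 _),
    abs_of_pos (by positivity : 0 < b * (1 - θ) ^ i * Real.Gamma (((i : ℝ) + 1) * θ)),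
    Real.Gamma_add_one hα.ne']
  calc _ ≤ |genBinom γ (i + 1)| * θ ^ (i + 1) /
        (b * (1 - θ) ^ i * Real.Gamma (((i : ℝ) + 1) * θ)) *
          ((T - t0) ^ (((i : ℝ) + 1) * θ) / (((i : ℝ) + 1) * θ) * M) := by
        gcongr
        refine h_int.trans ?_
        gcongr
        exact ht.2
    _ = _ := by field_simp

lemma fracTerm_sub {t0 b θ γ t : ℝ} (hθ0 : 0 < θ) (ht : t0 ≤ t) {g h : ℝ → ℝ}
    (hg : ContinuousOn g (Icc t0 t)) (hh : ContinuousOn h (Icc t0 t)) (i : ℕ) :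
    fracTerm t0 b θ γ g i t - fracTerm t0 b θ γ h i t =
      fracTerm t0 b θ γ (fun s => g s - h s) i t := by
  have hα : 0 < ((i : ℝ) + 1) * θ := by positivity
  simp only [fracTerm, mul_sub]
  rw [intervalIntegral.integral_sub (intervalIntegrable_sub_rpow_mul hα ht hg)
    (intervalIntegrable_sub_rpow_mul hα ht hh), mul_sub]

section Operator

variable {t0 T θ γ b A x0 : ℝ} {f : ℝ → ℝ → ℝ}

lemma continuousOn_comp_section
    (hfc : ContinuousOn (fun p : ℝ × ℝ => f p.1 p.2) (Icc t0 T ×ˢ univ)) {x : ℝ → ℝ}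
    (hx : ContinuousOn x (Icc t0 T)) : ContinuousOn (fun s => f s (x s)) (Icc t0 T) :=
  hfc.comp (continuousOn_id.prodMk hx) fun _ hs => ⟨hs, mem_univ _⟩

lemma summable_fracTerm (htT : t0 < T) (hθ0 : 0 < θ) (hθ1 : θ < 1) (hγ : 0 < γ) (hb : 0 < b)
    {g : ℝ → ℝ} (hg : ContinuousOn g (Icc t0 T)) {t : ℝ} (ht : t ∈ Icc t0 T) :
    Summable fun i => fracTerm t0 b θ γ g i t := by
  obtain ⟨M, hM⟩ := isCompact_Icc.exists_bound_of_continuousOn hg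
  exact Summable.of_norm_bounded
    ((summable_C2const_terms hθ0 hθ1 hγ (sub_pos.2 htT)).mul_right (M / b))
    fun i => abs_fracTerm_le hθ0 hθ1 hb ht (fun s hs => hM s ⟨hs.1, hs.2.trans ht.2⟩) i

lemma continuousOn_tsum_fracTerm (htT : t0 < T) (hθ0 : 0 < θ) (hθ1 : θ < 1) (hγ : 0 < γ)
    (hb : 0 < b) {g : ℝ → ℝ} (hg : ContinuousOn g (Icc t0 T)) :
    ContinuousOn (fun t => ∑' i, fracTerm t0 b θ γ g i t) (Icc t0 T) := by
  obtain ⟨M, hM⟩ := isCompact_Icc.exists_bound_of_continuousOn hg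
  refine continuousOn_tsum (fun i => ?_)
    ((summable_C2const_terms hθ0 hθ1 hγ (sub_pos.2 htT)).mul_right (M / b))
    fun i t ht => abs_fracTerm_le hθ0 hθ1 hb ht (fun s hs => hM s ⟨hs.1, hs.2.trans ht.2⟩) i
  exact continuousOn_const.mul
    (continuousOn_integral_sub_rpow_mul (by positivity) htT.le hg)

lemma UpsilonMuOne_eq_tsum_fracTerm (x : ℝ → ℝ) (t : ℝ) :
    UpsilonMuOne t0 b θ γ x0 f x t = x0 + ((1 - θ) / b) * f t (x t) +
      ∑' i, fracTerm t0 b θ γ (fun s => f s (x s)) i t := rfl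

lemma continuousOn_UpsilonMuOne (htT : t0 < T) (hθ0 : 0 < θ) (hθ1 : θ < 1) (hγ : 0 < γ)
    (hb : 0 < b) (hfc : ContinuousOn (fun p : ℝ × ℝ => f p.1 p.2) (Icc t0 T ×ˢ univ))
    {x : ℝ → ℝ} (hx : ContinuousOn x (Icc t0 T)) :
    ContinuousOn (UpsilonMuOne t0 b θ γ x0 f x) (Icc t0 T) :=
  (continuousOn_const.add (continuousOn_const.mul (continuousOn_comp_section hfc hx))).add
    (continuousOn_tsum_fracTerm htT hθ0 hθ1 hγ hb (continuousOn_comp_section hfc hx))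

lemma abs_UpsilonMuOne_sub_le (htT : t0 < T) (hθ0 : 0 < θ) (hθ1 : θ < 1) (hγ : 0 < γ)
    (hb : 0 < b) (hA : 0 < A)
    (hfc : ContinuousOn (fun p : ℝ × ℝ => f p.1 p.2) (Icc t0 T ×ˢ univ))
    (hLip : ∀ t ∈ Icc t0 T, ∀ y1 y2 : ℝ, |f t y1 - f t y2| ≤ A * |y1 - y2|)
    {x y : ℝ → ℝ} (hx : ContinuousOn x (Icc t0 T)) (hy : ContinuousOn y (Icc t0 T)) {d : ℝ}
    (hd : ∀ s ∈ Icc t0 T, |x s - y s| ≤ d) {t : ℝ} (ht : t ∈ Icc t0 T) :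
    |UpsilonMuOne t0 b θ γ x0 f x t - UpsilonMuOne t0 b θ γ x0 f y t| ≤
      C2const t0 T b θ γ A * d := by
  have h1 : 0 < 1 - θ := by linarith
  have hsub : Icc t0 t ⊆ Icc t0 T := Icc_subset_Icc_right ht.2
  have hfx := continuousOn_comp_section hfc hx
  have hfy := continuousOn_comp_section hfc hy
  have hfd : ∀ s ∈ Icc t0 T, |f s (x s) - f s (y s)| ≤ A * d := fun s hs =>
    (hLip s hs _ _).trans (mul_le_mul_of_nonneg_left (hd s hs) hA.le)
  have hsum : |∑' i, fracTerm t0 b θ γ (fun s => f s (x s)) i t -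
      ∑' i, fracTerm t0 b θ γ (fun s => f s (y s)) i t| ≤
      (∑' i : ℕ, |genBinom γ (i + 1)| * θ ^ (i + 1) * (T - t0) ^ (((i : ℝ) + 1) * θ) /
      ((1 - θ) ^ (i : ℕ) * Real.Gamma (((i : ℝ) + 1) * θ + 1))) * (A * d / b) := by
    rw [← (summable_fracTerm htT hθ0 hθ1 hγ hb hfx ht).tsum_sub
      (summable_fracTerm htT hθ0 hθ1 hγ hb hfy ht)]
    rw [← Real.norm_eq_abs]
    refine tsum_of_norm_bounded
      ((summable_C2const_terms hθ0 hθ1 hγ (sub_pos.2 htT)).hasSum.mul_right (A * d / b))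
      fun i => ?_
    rw [fracTerm_sub hθ0 ht.1 (hfx.mono hsub) (hfy.mono hsub)]
    exact abs_fracTerm_le hθ0 hθ1 hb ht (fun s hs => hfd s (hsub hs)) i
  have hzero : |(1 - θ) / b * (f t (x t) - f t (y t))| ≤ (1 - θ) / b * (A * d) := by
    rw [abs_mul, abs_of_pos (by positivity : 0 < (1 - θ) / b)]
    exact mul_le_mul_of_nonneg_left (hfd t ht) (by positivity)
  rw [UpsilonMuOne_eq_tsum_fracTerm, UpsilonMuOne_eq_tsum_fracTerm, C2const]
  calc _ = |(1 - θ) / b * (f t (x t) - f t (y t)) +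
        (∑' i, fracTerm t0 b θ γ (fun s => f s (x s)) i t -
          ∑' i, fracTerm t0 b θ γ (fun s => f s (y s)) i t)| := by
        congr 1
        ring
    _ ≤ _ := (abs_add_le _ _).trans (add_le_add hzero hsum)
    _ = _ := by ring

lemma mul_div_le_C2const (htT : t0 < T) (hθ0 : 0 < θ) (hθ1 : θ < 1) (hb : 0 < b) (hA : 0 < A) :
    (1 - θ) / b * A ≤ C2const t0 T b θ γ A := by
  have h1 : 0 < 1 - θ := by linarith
  have hL : 0 < T - t0 := sub_pos.2 htT
  have hsum : 0 ≤ ∑' i : ℕ, |genBinom γ (i + 1)| * θ ^ (i + 1) *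
      (T - t0) ^ (((i : ℝ) + 1) * θ) /
      ((1 - θ) ^ (i : ℕ) * Real.Gamma (((i : ℝ) + 1) * θ + 1)) := by
    refine tsum_nonneg fun i => ?_
    have : 0 < Real.Gamma (((i : ℝ) + 1) * θ + 1) := Real.Gamma_pos_of_pos (by positivity)
    positivity
  rw [C2const, mul_add, show (1 - θ) / b * A = A / b * (1 - θ) by ring]
  exact le_add_of_nonneg_right (mul_nonneg (by positivity) hsum)

lemma apply_left_eq_of_fixed (htT : t0 < T) (hθ0 : 0 < θ) (hθ1 : θ < 1) (hb : 0 < b)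
    (hA : 0 < A) (hLip : ∀ t ∈ Icc t0 T, ∀ y1 y2 : ℝ, |f t y1 - f t y2| ≤ A * |y1 - y2|)
    (hf0 : f t0 x0 = 0) (hC2 : C2const t0 T b θ γ A < 1) {x : ℝ → ℝ}
    (hx : x t0 = UpsilonMuOne t0 b θ γ x0 f x t0) : x t0 = x0 := by
  have h1 : 0 < (1 - θ) / b := div_pos (by linarith) hb
  have hc := (mul_div_le_C2const (γ := γ) htT hθ0 hθ1 hb hA).trans_lt hC2
  have hL := hLip t0 ⟨le_rfl, htT.le⟩ (x t0) x0
  have hx' : x t0 - x0 = (1 - θ) / b * f t0 (x t0) := by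
    simp only [UpsilonMuOne, intervalIntegral.integral_same, mul_zero, tsum_zero] at hx
    linarith
  have habs : |x t0 - x0| = (1 - θ) / b * |f t0 (x t0)| := by
    rw [hx', abs_mul, abs_of_pos h1]
  rw [hf0, sub_zero] at hL
  by_contra hne
  have hpos : 0 < |x t0 - x0| := abs_pos.2 (sub_ne_zero.2 hne)
  have := mul_le_mul_of_nonneg_left hL h1.le
  nlinarith

lemma UpsilonMuOne_congr {x y : ℝ → ℝ} {t : ℝ} (ht : t0 ≤ t) (h : EqOn x y (Icc t0 t)) :
    UpsilonMuOne t0 b θ γ x0 f x t = UpsilonMuOne t0 b θ γ x0 f y t := by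
  have h_int : ∀ i : ℕ, ∫ s in t0..t, (t - s) ^ (((i : ℝ) + 1) * θ - 1) * f s (x s) =
      ∫ s in t0..t, (t - s) ^ (((i : ℝ) + 1) * θ - 1) * f s (y s) := fun i => by
    refine intervalIntegral.integral_congr fun s hs => ?_
    rw [uIcc_of_le ht] at hs
    simp only [h hs]
  simp only [UpsilonMuOne, h_int, h ⟨ht, le_rfl⟩]

end Operator

/-- Existence and uniqueness, case `μ = 1`. -/
theorem existence_uniqueness_mu_eq_one
    (t0 T θ γ b A x0 : ℝ) (htT : t0 < T) (hθ0 : 0 < θ) (hθ1 : θ < 1)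
    (hγ : 0 < γ) (hb : 0 < b) (hA : 0 < A)
    (f : ℝ → ℝ → ℝ)
    (hfc : ContinuousOn (fun p : ℝ × ℝ => f p.1 p.2) (Set.Icc t0 T ×ˢ Set.univ))
    (hLip : ∀ t ∈ Set.Icc t0 T, ∀ y1 y2 : ℝ, |f t y1 - f t y2| ≤ A * |y1 - y2|)
    (hf0 : f t0 x0 = 0)
    (hC2 : C2const t0 T b θ γ A < 1) :
    ∃ x : ℝ → ℝ, ContinuousOn x (Set.Icc t0 T) ∧
      (∀ t ∈ Set.Icc t0 T, x t = UpsilonMuOne t0 b θ γ x0 f x t) ∧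
      x t0 = x0 ∧
      (∀ y : ℝ → ℝ, ContinuousOn y (Set.Icc t0 T) →
        (∀ t ∈ Set.Icc t0 T, y t = UpsilonMuOne t0 b θ γ x0 f y t) →
        ∀ t ∈ Set.Icc t0 T, y t = x t) := by
  set κ := C2const t0 T b θ γ A
  have hκ0 : 0 ≤ κ := le_trans (mul_nonneg (div_nonneg (by linarith) hb.le) hA.le)
    (mul_div_le_C2const htT hθ0 hθ1 hb hA)
  have hext : ∀ x : C(Icc t0 T, ℝ), ContinuousOn (IccExtend htT.le x) (Icc t0 T) :=
    fun x => x.continuous.Icc_extend'.continuousOn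
  let Φ : C(Icc t0 T, ℝ) → C(Icc t0 T, ℝ) := fun x =>
    ⟨(Icc t0 T).domRestrict (UpsilonMuOne t0 b θ γ x0 f (IccExtend htT.le x)),
      (continuousOn_UpsilonMuOne htT hθ0 hθ1 hγ hb hfc (hext x)).domRestrict⟩
  have hΦ : ContractingWith ⟨κ, hκ0⟩ Φ := by
    refine ⟨hC2, LipschitzWith.of_dist_le_mul fun x y => ?_⟩
    refine (ContinuousMap.dist_le (mul_nonneg hκ0 dist_nonneg)).2 fun t => ?_
    refine abs_UpsilonMuOne_sub_le htT hθ0 hθ1 hγ hb hA hfc hLip (hext x) (hext y)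
      (fun s _ => ?_) t.2
    exact ContinuousMap.dist_apply_le_dist (f := x) (g := y) (projIcc t0 T htT.le s)
  have : Nonempty C(Icc t0 T, ℝ) := ⟨0⟩
  set u : C(Icc t0 T, ℝ) := hΦ.fixedPoint Φ
  have hfix : Φ u = u := hΦ.fixedPoint_isFixedPt
  have hsol : ∀ t ∈ Icc t0 T, IccExtend htT.le u t =
      UpsilonMuOne t0 b θ γ x0 f (IccExtend htT.le u) t := fun t ht => by
    rw [IccExtend_of_mem _ _ ht]
    exact (DFunLike.congr_fun hfix ⟨t, ht⟩).symm
  refine ⟨IccExtend htT.le u, hext u, hsol,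
    apply_left_eq_of_fixed htT hθ0 hθ1 hb hA hLip hf0 hC2 (hsol t0 ⟨le_rfl, htT.le⟩),
    fun y hy hysol t ht => ?_⟩
  let v : C(Icc t0 T, ℝ) := ⟨(Icc t0 T).domRestrict y, hy.domRestrict⟩
  have hv : ∀ s (hs : s ∈ Icc t0 T), IccExtend htT.le v s = y s := fun s hs =>
    IccExtend_of_mem _ _ hs
  have hvfix : Φ v = v := by
    ext ⟨s, hs⟩
    refine Eq.trans ?_ (hysol s hs).symm
    exact UpsilonMuOne_congr hs.1 fun r hr => hv r ⟨hr.1, hr.2.trans hs.2⟩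
  have hvu : v = u := hΦ.fixedPoint_unique hvfix
  rw [← hv t ht, hvu]
end

section
/- Let t0 < T, θ ∈ (0,1), 0 < μ < 1, γ > 0, b > 0, r > 0, m > 0, k > 0, L > 0 and x0 ∈ ℝ with |x0| ≤ L. Set A = r(m + 2L(1 + m/k) + 3L²/k). If C1(T,A) < 1, then there is at most one continuous function x : [t0,T] → [−L, L] satisfying the integral equation x(t) = x0 + (I^{θ,μ,γ}(r x(·)(1 − x(·)/k)(x(·) − m)))(t) for all t ∈ [t0,T] (the integral-equation form of the generalized ABC cubic logistic model with right-hand side f(x) = r x (1 − x/k)(x − m)). -/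
open Real MeasureTheory Set

theorem Real.Gamma_mul_rpow_le_Gamma_add {x θ : ℝ} (hx : 1 ≤ x) (hθ0 : 0 < θ) (hθ1 : θ < 1) :
    Real.Gamma x * (x + θ - 1) ^ θ ≤ Real.Gamma (x + θ) := by
  have hpos : 0 < x + θ - 1 := by linarith
  have hG : 0 < Real.Gamma (x + θ) := Real.Gamma_pos_of_pos (by linarith)
  have hG1 : 0 < Real.Gamma (x + θ - 1) := Real.Gamma_pos_of_pos hpos
  have hconv := Real.Gamma_mul_add_mul_le_rpow_Gamma_mul_rpow_Gamma hpos
    (show 0 < x + θ by linarith) hθ0 (show 0 < 1 - θ by linarith) (by ring)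
  rw [show θ * (x + θ - 1) + (1 - θ) * (x + θ) = x by ring] at hconv
  have hrec : Real.Gamma (x + θ) = (x + θ - 1) * Real.Gamma (x + θ - 1) := by
    rw [← Real.Gamma_add_one hpos.ne']
    ring_nf
  calc Real.Gamma x * (x + θ - 1) ^ θ
      ≤ Real.Gamma (x + θ - 1) ^ θ * Real.Gamma (x + θ) ^ (1 - θ) * (x + θ - 1) ^ θ := by gcongr
    _ = ((x + θ - 1) * Real.Gamma (x + θ - 1)) ^ θ * Real.Gamma (x + θ) ^ (1 - θ) := by
        rw [Real.mul_rpow hpos.le hG1.le]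
        ring
    _ = Real.Gamma (x + θ) := by
        rw [← hrec, ← Real.rpow_add hG]
        simp

theorem genBinom_succ (γ : ℝ) (i : ℕ) :
    genBinom γ (i + 1) = genBinom γ i * ((γ - i) / (i + 1)) := by
  unfold genBinom
  rw [Finset.prod_range_succ, Nat.factorial_succ]
  push_cast
  field_simp

theorem abs_genBinom_succ_le {γ : ℝ} (hγ : 0 < γ) {i : ℕ} (hi : γ ≤ i) :
    |genBinom γ (i + 1)| ≤ |genBinom γ i| := by
  rw [genBinom_succ, abs_mul]
  refine mul_le_of_le_one_right (abs_nonneg _) ?_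
  have h : (0 : ℝ) < i + 1 := by positivity
  rw [abs_div, abs_of_pos h, div_le_one h, abs_of_nonpos (by linarith)]
  linarith

/-- The `i`-th term of the series defining `C1const`, for an interval of length `D`. -/
noncomputable def C1term (θ μ γ D : ℝ) (i : ℕ) : ℝ :=
  |genBinom γ i| * θ ^ i * D ^ ((i : ℝ) * θ + 1 - μ) /
    ((1 - θ) ^ ((i : ℝ) - 1) * Real.Gamma ((i : ℝ) * θ + 2 - μ))

section

variable {θ μ γ : ℝ}

theorem C1term_nonneg (hθ0 : 0 < θ) (hθ1 : θ < 1) (hμ1 : μ < 1) {D : ℝ} (hD : 0 ≤ D) (i : ℕ) :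
    0 ≤ C1term θ μ γ D i := by
  have h1 : 0 < 1 - θ := by linarith
  have hi : 0 ≤ (i : ℝ) * θ := by positivity
  have hG : 0 < Real.Gamma ((i : ℝ) * θ + 2 - μ) := Real.Gamma_pos_of_pos (by linarith)
  unfold C1term
  positivity

theorem C1term_mono (hθ0 : 0 < θ) (hθ1 : θ < 1) (hμ1 : μ < 1) {D E : ℝ} (hD : 0 ≤ D)
    (hDE : D ≤ E) (i : ℕ) : C1term θ μ γ D i ≤ C1term θ μ γ E i := by
  have h1 : 0 < 1 - θ := by linarith
  have hi : 0 ≤ (i : ℝ) * θ := by positivity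
  have hG : 0 < Real.Gamma ((i : ℝ) * θ + 2 - μ) := Real.Gamma_pos_of_pos (by linarith)
  have hp : 0 ≤ (i : ℝ) * θ + 1 - μ := by linarith
  unfold C1term
  gcongr

theorem C1term_succ_le (hθ0 : 0 < θ) (hθ1 : θ < 1) (hμ1 : μ < 1) (hγ : 0 < γ)
    {D : ℝ} (hD : 0 < D) {i : ℕ} (hi : γ ≤ i) :
    C1term θ μ γ D (i + 1) ≤
      θ * D ^ θ / ((1 - θ) * ((i : ℝ) * θ + 2 - μ + θ - 1) ^ θ) * C1term θ μ γ D i := by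
  have h1 : 0 < 1 - θ := by linarith
  have hiθ : 0 ≤ (i : ℝ) * θ := by positivity
  have hG : 0 < Real.Gamma ((i : ℝ) * θ + 2 - μ) := Real.Gamma_pos_of_pos (by linarith)
  have hpos : 0 < (i : ℝ) * θ + 2 - μ + θ - 1 := by linarith
  have hΓ := Real.Gamma_mul_rpow_le_Gamma_add (x := (i : ℝ) * θ + 2 - μ) (by linarith) hθ0 hθ1
  have hb := abs_genBinom_succ_le hγ hi
  have e1 : ((i + 1 : ℕ) : ℝ) * θ + 2 - μ = (i : ℝ) * θ + 2 - μ + θ := by push_cast; ring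
  have e2 : ((i + 1 : ℕ) : ℝ) * θ + 1 - μ = ((i : ℝ) * θ + 1 - μ) + θ := by push_cast; ring
  have e3 : ((i + 1 : ℕ) : ℝ) - 1 = ((i : ℝ) - 1) + 1 := by push_cast; ring
  unfold C1term
  rw [e1, e2, e3, Real.rpow_add hD, Real.rpow_add_one h1.ne', pow_succ]
  calc |genBinom γ (i + 1)| * (θ ^ i * θ) * (D ^ ((i : ℝ) * θ + 1 - μ) * D ^ θ) /
        ((1 - θ) ^ ((i : ℝ) - 1) * (1 - θ) * Real.Gamma ((i : ℝ) * θ + 2 - μ + θ))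
      ≤ |genBinom γ i| * (θ ^ i * θ) * (D ^ ((i : ℝ) * θ + 1 - μ) * D ^ θ) /
        ((1 - θ) ^ ((i : ℝ) - 1) * (1 - θ) *
          (Real.Gamma ((i : ℝ) * θ + 2 - μ) * ((i : ℝ) * θ + 2 - μ + θ - 1) ^ θ)) := by
        gcongr
    _ = _ := by
        simp only [div_eq_mul_inv, mul_inv]
        ring

theorem summable_C1term (hθ0 : 0 < θ) (hθ1 : θ < 1) (hμ1 : μ < 1) (hγ : 0 < γ)
    {D : ℝ} (hD : 0 < D) : Summable (C1term θ μ γ D) := by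
  have h1 : 0 < 1 - θ := by linarith
  have hlin : Filter.Tendsto (fun i : ℕ => (i : ℝ) * θ + 2 - μ + θ - 1)
      Filter.atTop Filter.atTop := by
    have h := Filter.tendsto_atTop_add_const_right Filter.atTop (1 - μ + θ)
      ((tendsto_natCast_atTop_atTop (R := ℝ)).atTop_mul_const hθ0)
    refine h.congr fun i => ?_
    ring
  have hratio : Filter.Tendsto
      (fun i : ℕ => θ * D ^ θ / ((1 - θ) * ((i : ℝ) * θ + 2 - μ + θ - 1) ^ θ))
      Filter.atTop (nhds 0) :=
    (((tendsto_rpow_atTop hθ0).comp hlin).const_mul_atTop h1).const_div_atTop _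
  refine summable_of_ratio_norm_eventually_le (r := 1 / 2) (by norm_num) ?_
  filter_upwards [hratio.eventually_le_const (show (0 : ℝ) < 1 / 2 by norm_num),
    (tendsto_natCast_atTop_atTop (R := ℝ)).eventually_ge_atTop γ] with i hi hiγ
  rw [Real.norm_of_nonneg (C1term_nonneg hθ0 hθ1 hμ1 hD.le _),
    Real.norm_of_nonneg (C1term_nonneg hθ0 hθ1 hμ1 hD.le _)]
  exact (C1term_succ_le hθ0 hθ1 hμ1 hγ hD hiγ).trans
    (mul_le_mul_of_nonneg_right hi (C1term_nonneg hθ0 hθ1 hμ1 hD.le _))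

/-- The `i`-th term of the series defining `ABIntegral`. -/
noncomputable def ABterm (t0 b θ μ γ : ℝ) (η : ℝ → ℝ) (t : ℝ) (i : ℕ) : ℝ :=
  genBinom γ i * θ ^ i /
      (b * (1 - θ) ^ ((i : ℝ) - 1) * Real.Gamma ((i : ℝ) * θ + 1 - μ)) *
    ∫ s in t0..t, (t - s) ^ ((i : ℝ) * θ - μ) * η s

theorem intervalIntegrable_sub_rpow {p : ℝ} (hp : -1 < p) (t0 t : ℝ) :
    IntervalIntegrable (fun s => (t - s) ^ p) volume t0 t := by
  have h := (intervalIntegral.intervalIntegrable_rpow' (a := t - t0) (b := 0) hp).comp_sub_left t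
  simpa using h

theorem integral_sub_rpow {p : ℝ} (hp : -1 < p) (t0 t : ℝ) :
    ∫ s in t0..t, (t - s) ^ p = (t - t0) ^ (p + 1) / (p + 1) := by
  rw [intervalIntegral.integral_comp_sub_left (fun u => u ^ p) t, integral_rpow (Or.inl hp)]
  simp [Real.zero_rpow (show p + 1 ≠ 0 by linarith)]

variable {t0 t b : ℝ}

theorem norm_integral_sub_rpow_mul_le {p M : ℝ} (hp : -1 < p) (ht : t0 ≤ t) {η : ℝ → ℝ}
    (hM : ∀ s ∈ Set.Icc t0 t, |η s| ≤ M) :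
    ‖∫ s in t0..t, (t - s) ^ p * η s‖ ≤ M * ((t - t0) ^ (p + 1) / (p + 1)) := by
  rw [← integral_sub_rpow hp, ← intervalIntegral.integral_const_mul]
  refine intervalIntegral.norm_integral_le_of_norm_le ht (.of_forall fun s hs => ?_)
    ((intervalIntegrable_sub_rpow hp t0 t).const_mul M)
  have h : 0 ≤ (t - s) ^ p := Real.rpow_nonneg (by linarith [hs.2]) _
  rw [norm_mul, Real.norm_of_nonneg h, mul_comm]
  exact mul_le_mul_of_nonneg_right (hM s ⟨hs.1.le, hs.2⟩) h

theorem norm_ABterm_le (hθ0 : 0 < θ) (hθ1 : θ < 1) (hμ1 : μ < 1) (hb : 0 < b) (ht : t0 ≤ t)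
    {η : ℝ → ℝ} {M : ℝ} (hM : ∀ s ∈ Set.Icc t0 t, |η s| ≤ M) (i : ℕ) :
    ‖ABterm t0 b θ μ γ η t i‖ ≤ M / b * C1term θ μ γ (t - t0) i := by
  have h1 : 0 < 1 - θ := by linarith
  have hiθ : 0 ≤ (i : ℝ) * θ := by positivity
  have hq : 0 < (i : ℝ) * θ + 1 - μ := by linarith
  have hG : 0 < Real.Gamma ((i : ℝ) * θ + 1 - μ) := Real.Gamma_pos_of_pos hq
  have hden : 0 < b * (1 - θ) ^ ((i : ℝ) - 1) * Real.Gamma ((i : ℝ) * θ + 1 - μ) := by positivity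
  have hΓ : Real.Gamma ((i : ℝ) * θ + 2 - μ) =
      ((i : ℝ) * θ + 1 - μ) * Real.Gamma ((i : ℝ) * θ + 1 - μ) := by
    rw [← Real.Gamma_add_one hq.ne']
    ring_nf
  have hint := norm_integral_sub_rpow_mul_le (p := (i : ℝ) * θ - μ) (by linarith) ht hM
  rw [show (i : ℝ) * θ - μ + 1 = (i : ℝ) * θ + 1 - μ by ring] at hint
  unfold ABterm C1term
  rw [norm_mul, norm_div, Real.norm_of_nonneg hden.le, norm_mul,
    Real.norm_of_nonneg (pow_nonneg hθ0.le i), Real.norm_eq_abs (genBinom γ i), hΓ]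
  refine (mul_le_mul_of_nonneg_left hint (by positivity)).trans_eq ?_
  field_simp

theorem summable_ABterm (hθ0 : 0 < θ) (hθ1 : θ < 1) (hμ1 : μ < 1) (hγ : 0 < γ) (hb : 0 < b)
    (ht : t0 < t) {η : ℝ → ℝ} (hη : ContinuousOn η (Set.Icc t0 t)) :
    Summable (ABterm t0 b θ μ γ η t) := by
  obtain ⟨M, hM⟩ := isCompact_Icc.exists_bound_of_continuousOn hη
  exact .of_norm_bounded ((summable_C1term hθ0 hθ1 hμ1 hγ (sub_pos.2 ht)).mul_left (M / b))
    (norm_ABterm_le hθ0 hθ1 hμ1 hb ht.le hM)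

theorem ABterm_sub (hθ0 : 0 < θ) (hμ1 : μ < 1) (ht : t0 ≤ t) {η₁ η₂ : ℝ → ℝ}
    (h₁ : ContinuousOn η₁ (Set.Icc t0 t)) (h₂ : ContinuousOn η₂ (Set.Icc t0 t)) (i : ℕ) :
    ABterm t0 b θ μ γ (η₁ - η₂) t i = ABterm t0 b θ μ γ η₁ t i - ABterm t0 b θ μ γ η₂ t i := by
  have hiθ : 0 ≤ (i : ℝ) * θ := by positivity
  have hw := intervalIntegrable_sub_rpow (p := (i : ℝ) * θ - μ) (by linarith) t0 t
  rw [← Set.uIcc_of_le ht] at h₁ h₂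
  unfold ABterm
  rw [← mul_sub, ← intervalIntegral.integral_sub (hw.mul_continuousOn h₁) (hw.mul_continuousOn h₂)]
  simp [mul_sub]

theorem abs_ABIntegral_sub_le {T : ℝ} (hθ0 : 0 < θ) (hθ1 : θ < 1) (hμ1 : μ < 1) (hγ : 0 < γ)
    (hb : 0 < b) (htT : t0 < T) (ht : t ∈ Set.Icc t0 T) {η₁ η₂ : ℝ → ℝ}
    (h₁ : ContinuousOn η₁ (Set.Icc t0 T)) (h₂ : ContinuousOn η₂ (Set.Icc t0 T)) {M : ℝ}
    (hM : ∀ s ∈ Set.Icc t0 T, |η₁ s - η₂ s| ≤ M) :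
    |ABIntegral t0 b θ μ γ η₁ t - ABIntegral t0 b θ μ γ η₂ t| ≤ C1const t0 T b θ μ γ M := by
  have hM0 : 0 ≤ M := (abs_nonneg _).trans (hM t ht)
  have hsum := (summable_C1term (μ := μ) hθ0 hθ1 hμ1 hγ (sub_pos.2 htT)).mul_left (M / b)
  have hC : C1const t0 T b θ μ γ M = ∑' i, M / b * C1term θ μ γ (T - t0) i := tsum_mul_left.symm
  have hAB (η : ℝ → ℝ) : ABIntegral t0 b θ μ γ η t = ∑' i, ABterm t0 b θ μ γ η t i := rfl
  rw [hC, hAB, hAB]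
  obtain rfl | hlt := ht.1.eq_or_lt
  · simpa [ABterm] using tsum_nonneg fun i =>
      mul_nonneg (div_nonneg hM0 hb.le) (C1term_nonneg hθ0 hθ1 hμ1 (sub_nonneg.2 htT.le) i)
  have hsub : Set.Icc t0 t ⊆ Set.Icc t0 T := Set.Icc_subset_Icc_right ht.2
  rw [← Real.norm_eq_abs, ← (summable_ABterm hθ0 hθ1 hμ1 hγ hb hlt (h₁.mono hsub)).tsum_sub
    (summable_ABterm hθ0 hθ1 hμ1 hγ hb hlt (h₂.mono hsub))]
  refine tsum_of_norm_bounded hsum.hasSum fun i => ?_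
  rw [← ABterm_sub hθ0 hμ1 ht.1 (h₁.mono hsub) (h₂.mono hsub)]
  refine (norm_ABterm_le hθ0 hθ1 hμ1 hb ht.1 (fun s hs => hM s (hsub hs)) i).trans ?_
  exact mul_le_mul_of_nonneg_left
    (C1term_mono hθ0 hθ1 hμ1 (sub_nonneg.2 ht.1) (by linarith [ht.2]) i) (div_nonneg hM0 hb.le)

end

theorem abs_cubic_sub_le {r m k L x y : ℝ} (hr : 0 < r) (hm : 0 < m) (hk : 0 < k)
    (hx : |x| ≤ L) (hy : |y| ≤ L) :
    |r * x * (1 - x / k) * (x - m) - r * y * (1 - y / k) * (y - m)| ≤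
      r * (m + 2 * L * (1 + m / k) + 3 * L ^ 2 / k) * |x - y| := by
  have hfac : r * x * (1 - x / k) * (x - m) - r * y * (1 - y / k) * (y - m) =
      r * (-m + (x + y) * (1 + m / k) - (x ^ 2 + x * y + y ^ 2) / k) * (x - y) := by
    field_simp
    ring
  have hL : 0 ≤ L := (abs_nonneg x).trans hx
  have hlin : |(x + y) * (1 + m / k)| ≤ 2 * L * (1 + m / k) := by
    rw [abs_mul, abs_of_pos (show 0 < 1 + m / k by positivity)]
    gcongr
    linarith [abs_add_le x y]
  have hquad : |(x ^ 2 + x * y + y ^ 2) / k| ≤ 3 * L ^ 2 / k := by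
    rw [abs_div, abs_of_pos hk]
    gcongr
    have hxx : |x| * |x| ≤ L * L := by gcongr
    have hxy : |x| * |y| ≤ L * L := by gcongr
    have hyy : |y| * |y| ≤ L * L := by gcongr
    calc |x ^ 2 + x * y + y ^ 2| ≤ |x ^ 2| + |x * y| + |y ^ 2| := abs_add_three _ _ _
      _ ≤ 3 * L ^ 2 := by
        rw [abs_mul, abs_pow, abs_pow]
        linarith
  rw [hfac, abs_mul, abs_mul, abs_of_pos hr]
  gcongr
  rw [abs_le] at *
  constructor <;> linarith [hlin.1, hlin.2, hquad.1, hquad.2]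

/-- Uniqueness for the generalized ABC cubic logistic model. -/
theorem cubic_logistic_uniqueness
    (t0 T θ μ γ b r m k L x0 : ℝ) (htT : t0 < T) (hθ0 : 0 < θ) (hθ1 : θ < 1)
    (hμ0 : 0 < μ) (hμ1 : μ < 1) (hγ : 0 < γ) (hb : 0 < b)
    (hr : 0 < r) (hm : 0 < m) (hk : 0 < k) (hL : 0 < L)
    (hx0 : |x0| ≤ L)
    (hC1 : C1const t0 T b θ μ γ (r * (m + 2 * L * (1 + m / k) + 3 * L ^ 2 / k)) < 1)
    (x1 x2 : ℝ → ℝ)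
    (h1c : ContinuousOn x1 (Set.Icc t0 T))
    (h2c : ContinuousOn x2 (Set.Icc t0 T))
    (h1m : ∀ t ∈ Set.Icc t0 T, x1 t ∈ Set.Icc (-L) L)
    (h2m : ∀ t ∈ Set.Icc t0 T, x2 t ∈ Set.Icc (-L) L)
    (h1e : ∀ t ∈ Set.Icc t0 T,
      x1 t = x0 + ABIntegral t0 b θ μ γ (fun s => r * x1 s * (1 - x1 s / k) * (x1 s - m)) t)
    (h2e : ∀ t ∈ Set.Icc t0 T,
      x2 t = x0 + ABIntegral t0 b θ μ γ (fun s => r * x2 s * (1 - x2 s / k) * (x2 s - m)) t) :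
    ∀ t ∈ Set.Icc t0 T, x1 t = x2 t := by
  set A := r * (m + 2 * L * (1 + m / k) + 3 * L ^ 2 / k)
  obtain ⟨u, hu, humax⟩ := isCompact_Icc.exists_isMaxOn (Set.nonempty_Icc.2 htT.le)
    (h1c.sub h2c).abs
  have hmax (s : ℝ) (hs : s ∈ Set.Icc t0 T) : |x1 s - x2 s| ≤ |x1 u - x2 u| := humax hs
  have hA0 : 0 ≤ A := by positivity
  have hbound := abs_ABIntegral_sub_le (μ := μ) (M := A * |x1 u - x2 u|) hθ0 hθ1 hμ1 hγ hb htT hu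
    (η₁ := fun s => r * x1 s * (1 - x1 s / k) * (x1 s - m))
    (η₂ := fun s => r * x2 s * (1 - x2 s / k) * (x2 s - m)) (by fun_prop) (by fun_prop)
    fun s hs => (abs_cubic_sub_le hr hm hk (abs_le.2 (h1m s hs)) (abs_le.2 (h2m s hs))).trans
      (mul_le_mul_of_nonneg_left (hmax s hs) hA0)
  have hscale : C1const t0 T b θ μ γ (A * |x1 u - x2 u|) =
      C1const t0 T b θ μ γ A * |x1 u - x2 u| := by
    unfold C1const
    ring
  rw [hscale, ← add_sub_add_left_eq_sub _ _ x0, ← h1e u hu, ← h2e u hu] at hbound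
  have hzero : |x1 u - x2 u| ≤ 0 := by
    by_contra! hpos
    exact absurd hbound (not_le.2 (mul_lt_of_lt_one_left hpos hC1))
  intro t ht
  exact sub_eq_zero.1 (abs_nonpos_iff.1 ((hmax t ht).trans hzero))
end

section
/- Let θ ∈ (0,1), 0 < μ < 1, γ > 0, b > 0, ρ ∈ ℝ, a0 ∈ ℝ, t0 ∈ ℝ and λ = −θ/(1−θ). Define α : [t0,∞) → ℝ by α(t) = a0 Σ_{j=0}^∞ ρ^j ((1−θ)/b)^j E_{θ, j(1−μ)+1}^{−γj}(λ, t − t0), where the j = 0 term is interpreted as 1. Then α(t0) = a0 and α satisfies the linear generalized ABC fractional equation (D^{θ,μ,γ}α)(t) = ρ α(t) for all t > t0. -/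
open Real MeasureTheory Set

/-- The Riemann-Liouville kernel `z^(p-1) / Γ(p)`. -/
noncomputable def rlKernel (p z : ℝ) : ℝ := z ^ (p - 1) / Real.Gamma p

/-- The coefficient `λ^k (ρ)_k / k!` of the generalized Mittag-Leffler series. -/
noncomputable def mlCoeff (ρ lam : ℝ) (k : ℕ) : ℝ :=
  lam ^ k * (risingFac ρ k / (Nat.factorial k : ℝ))

theorem mittagLeffler_eq_tsum_rlKernel (θ β ρ lam z : ℝ) :
    mittagLeffler θ β ρ lam z = ∑' k : ℕ, mlCoeff ρ lam k * rlKernel (k * θ + β) z := by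
  unfold mittagLeffler mlCoeff rlKernel
  refine tsum_congr fun k => ?_
  simp only [add_sub_assoc, div_eq_mul_inv, mul_inv]
  ring

theorem rlKernel_nonneg {p z : ℝ} (hp : 0 < p) (hz : 0 ≤ z) : 0 ≤ rlKernel p z :=
  div_nonneg (rpow_nonneg hz _) (Real.Gamma_pos_of_pos hp).le

theorem rlKernel_pos {p z : ℝ} (hp : 0 < p) (hz : 0 < z) : 0 < rlKernel p z :=
  div_pos (rpow_pos_of_pos hz _) (Real.Gamma_pos_of_pos hp)

theorem hasDerivAt_rlKernel_add_one {p z : ℝ} (hp : 0 < p) (hz : 0 < z) :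
    HasDerivAt (rlKernel (p + 1)) (rlKernel p z) z := by
  have h := (Real.hasDerivAt_rpow_const (p := p) (Or.inl hz.ne')).div_const (Real.Gamma (p + 1))
  unfold rlKernel
  rw [Real.Gamma_add_one hp.ne'] at h ⊢
  rw [mul_div_mul_left _ _ hp.ne'] at h
  simpa only [add_sub_cancel_right] using h

theorem integral_rlKernel_mul {p q a : ℝ} (hp : 0 < p) (hq : 0 < q) (ha : 0 < a) :
    ∫ x in Ioc 0 a, rlKernel p (a - x) * rlKernel q x = rlKernel (p + q) a := by
  have h := Complex.betaIntegral_scaled (q : ℂ) (p : ℂ) ha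
  have hG := Complex.Gamma_mul_Gamma_eq_betaIntegral (s := (q : ℂ)) (t := (p : ℂ))
    (by simpa using hq) (by simpa using hp)
  have hpq : Real.Gamma (q + p) ≠ 0 := (Real.Gamma_pos_of_pos (add_pos hq hp)).ne'
  have hpqc : Complex.Gamma (q + p) ≠ 0 := by
    rw [← Complex.ofReal_add, Complex.Gamma_ofReal]
    exact_mod_cast hpq
  have hB : Complex.betaIntegral q p =
      ((Real.Gamma q * Real.Gamma p / Real.Gamma (q + p) : ℝ) : ℂ) := by
    rw [← mul_right_inj' hpqc, ← hG, ← Complex.ofReal_add]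
    simp only [Complex.Gamma_ofReal]
    rw [← Complex.ofReal_mul, ← Complex.ofReal_mul, mul_div_cancel₀ _ hpq]
  have hR : ∫ x in Ioc 0 a, x ^ (q - 1) * (a - x) ^ (p - 1) =
      a ^ (q + p - 1) * (Real.Gamma q * Real.Gamma p / Real.Gamma (q + p)) := by
    rw [hB, intervalIntegral.integral_of_le ha.le] at h
    apply Complex.ofReal_injective
    rw [← integral_complex_ofReal]
    push_cast
    rw [Complex.ofReal_cpow ha.le]
    push_cast
    push_cast at h
    rw [← h]
    refine setIntegral_congr_fun measurableSet_Ioc fun x hx => ?_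
    simp only [Complex.ofReal_cpow hx.1.le, Complex.ofReal_cpow (sub_nonneg.2 hx.2)]
    push_cast
    rfl
  have hp' := (Real.Gamma_pos_of_pos hp).ne'
  have hq' := (Real.Gamma_pos_of_pos hq).ne'
  have : ∀ x, rlKernel p (a - x) * rlKernel q x =
      (Real.Gamma q * Real.Gamma p)⁻¹ * (x ^ (q - 1) * (a - x) ^ (p - 1)) := by
    intro x
    unfold rlKernel
    field_simp
  simp_rw [this]
  rw [integral_const_mul, hR, rlKernel, add_comm p q]
  field_simp

theorem integrableOn_rlKernel_mul {p q a : ℝ} (hp : 0 < p) (hq : 0 < q) (ha : 0 < a) :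
    IntegrableOn (fun x => rlKernel p (a - x) * rlKernel q x) (Ioc 0 a) := by
  by_contra h
  have := integral_rlKernel_mul hp hq ha
  rw [integral_undef h] at this
  exact (rlKernel_pos (add_pos hp hq) ha).ne this

theorem exists_inv_Gamma_le {M : ℝ} (hM : 1 ≤ M) :
    ∃ C, 0 < C ∧ ∀ x, 0 < x → (Real.Gamma x)⁻¹ ≤ C * M ^ (-x) := by
  refine ⟨Real.exp (2 * M + 1), Real.exp_pos _, fun x hx => ?_⟩
  have hM0 : 0 < M := by linarith
  have hlow : Real.exp (-(2 * M + 1)) * (2 * M) ^ x ≤ Real.Gamma (x + 1) := by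
    have hx1 : 0 < x + 1 := by linarith
    have hint := Real.GammaIntegral_convergent hx1
    rw [Real.Gamma_eq_integral hx1]
    have hsub : Ioc (2 * M) (2 * M + 1) ⊆ Ioi 0 := fun y hy => by
      have := hy.1
      simp only [mem_Ioi]; linarith
    have h1 : ∫ _ in Ioc (2 * M) (2 * M + 1), Real.exp (-(2 * M + 1)) * (2 * M) ^ x ≤
        ∫ y in Ioc (2 * M) (2 * M + 1), Real.exp (-y) * y ^ (x + 1 - 1) := by
      refine setIntegral_mono_on (integrableOn_const (by simp)) (hint.mono_set hsub)
        measurableSet_Ioc fun y hy => ?_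
      rw [add_sub_cancel_right]
      have := hy.1
      have := hy.2
      gcongr
    have h2 : ∫ y in Ioc (2 * M) (2 * M + 1), Real.exp (-y) * y ^ (x + 1 - 1) ≤
        ∫ y in Ioi 0, Real.exp (-y) * y ^ (x + 1 - 1) := by
      refine setIntegral_mono_set hint ?_ hsub.eventuallyLE
      filter_upwards [ae_restrict_mem measurableSet_Ioi] with y hy
      have : 0 < y := hy
      simp only [Pi.zero_apply]
      positivity
    refine le_trans (le_of_eq ?_) (h1.trans h2)
    simp
  have hG := Real.Gamma_pos_of_pos hx
  rw [Real.Gamma_add_one hx.ne', Real.mul_rpow two_pos.le hM0.le] at hlow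
  have hx2 : x ≤ 2 ^ x := by
    have h := Real.add_one_le_exp (x * Real.log 2)
    rw [mul_comm x, ← Real.rpow_def_of_pos two_pos] at h
    have h1 := one_add_mul_self_le_rpow_one_add (s := 1) (p := x) (by norm_num)
    rcases le_total 1 x with h2 | h2
    · have := h1 h2
      norm_num at this
      linarith
    · exact h2.trans (Real.one_le_rpow one_le_two hx.le)
  rw [Real.exp_neg] at hlow
  rw [Real.rpow_neg hM0.le, ← div_eq_mul_inv, inv_eq_one_div, div_le_div_iff₀ hG (by positivity)]
  have h3 : (2:ℝ) ^ x * M ^ x ≤ Real.exp (2 * M + 1) * (x * Real.Gamma x) := by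
    rwa [← div_eq_inv_mul, div_le_iff₀' (Real.exp_pos _)] at hlow
  have h4 : x * M ^ x ≤ 2 ^ x * M ^ x := by gcongr
  have h5 := h4.trans h3
  rw [mul_left_comm] at h5
  linarith [le_of_mul_le_mul_left h5 hx]

theorem abs_risingFac_div_factorial_le {y : ℝ} {N : ℕ} (hy : |y| ≤ N) (k : ℕ) :
    |risingFac y k / (Nat.factorial k : ℝ)| ≤ 2 ^ N * 2 ^ k := by
  have h1 : |risingFac y k| ≤ ((N + 1).ascFactorial k : ℝ) := by
    rw [Nat.ascFactorial_eq_prod_range, risingFac, Finset.abs_prod, Nat.cast_prod]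
    refine Finset.prod_le_prod (fun _ _ => abs_nonneg _) fun i _ => ?_
    refine (abs_add_le _ _).trans ?_
    rw [Nat.abs_cast]
    push_cast
    linarith
  have hk : (0:ℝ) < Nat.factorial k := by positivity
  rw [abs_div, abs_of_pos hk, div_le_iff₀ hk]
  refine h1.trans ?_
  rw [Nat.ascFactorial_eq_factorial_mul_choose, mul_comm, ← pow_add]
  have : ((N + k).choose k : ℝ) ≤ 2 ^ (N + k) := by exact_mod_cast Nat.choose_le_two_pow _ _
  push_cast
  gcongr

theorem abs_mlCoeff_le {y lam : ℝ} {N : ℕ} (hy : |y| ≤ N) (k : ℕ) :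
    |mlCoeff y lam k| ≤ 2 ^ N * (2 * |lam|) ^ k := by
  rw [mlCoeff, abs_mul, abs_pow]
  calc _ ≤ |lam| ^ k * (2 ^ N * 2 ^ k) := by
        gcongr; exact abs_risingFac_div_factorial_le hy k
    _ = _ := by rw [mul_pow]; ring

theorem mlCoeff_zero_right (y lam : ℝ) : mlCoeff y lam 0 = 1 := by
  simp [mlCoeff, risingFac]

theorem mlCoeff_zero_left (lam : ℝ) {k : ℕ} (hk : k ≠ 0) : mlCoeff 0 lam k = 0 := by
  have : risingFac 0 k = 0 :=
    Finset.prod_eq_zero (Finset.mem_range.2 (Nat.pos_of_ne_zero hk)) (by simp)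
  simp [mlCoeff, this]

theorem risingFac_div_factorial (y : ℝ) (k : ℕ) :
    risingFac y k / (Nat.factorial k : ℝ) = (-1) ^ k * Ring.choose (-y) k := by
  have h1 := Ring.descPochhammer_eq_factorial_smul_choose (-y) k
  have h2 : risingFac y k = (-1) ^ k * (descPochhammer ℤ k).smeval (-y) := by
    rw [← Polynomial.aeval_eq_smeval, ← Polynomial.eval_map_algebraMap, algebraMap_int_eq,
      descPochhammer_map, descPochhammer_eval_eq_prod_range, risingFac,
      ← Finset.card_range k, ← Finset.prod_const, Finset.card_range, ← Finset.prod_mul_distrib]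
    exact Finset.prod_congr rfl fun i _ => by ring
  rw [h2, h1, nsmul_eq_mul]
  have : (Nat.factorial k : ℝ) ≠ 0 := by positivity
  field_simp

theorem sum_antidiagonal_mlCoeff (x y lam : ℝ) (n : ℕ) :
    ∑ p ∈ Finset.HasAntidiagonal.antidiagonal n, mlCoeff x lam p.1 * mlCoeff y lam p.2 =
      mlCoeff (x + y) lam n := by
  simp only [mlCoeff, risingFac_div_factorial]
  rw [neg_add, Ring.add_choose_eq n (Commute.all (-x) (-y)), Finset.mul_sum, Finset.mul_sum]
  refine Finset.sum_congr rfl fun p hp => ?_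
  rw [← Finset.HasAntidiagonal.mem_antidiagonal.1 hp, pow_add, pow_add]
  ring

theorem exists_mul_rlKernel_le {θ ν δ A B z : ℝ} (hθ : 0 < θ) (hν : 0 < ν) (hδ : 0 < δ)
    (hA : 0 ≤ A) (hB : 0 ≤ B) (hz : 0 < z) :
    ∃ C, 0 ≤ C ∧ ∀ j k : ℕ,
      A ^ j * B ^ k * rlKernel (k * θ + j * ν + δ) z ≤ C * (2⁻¹ ^ j * 2⁻¹ ^ k) := by
  obtain ⟨M, hM1, hMθ, hMν⟩ : ∃ M : ℝ, 1 ≤ M ∧ 2 * (B * z ^ θ) ≤ M ^ θ ∧ 2 * (A * z ^ ν) ≤ M ^ ν :=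
    ((Filter.eventually_ge_atTop 1).and
      (((tendsto_rpow_atTop hθ).eventually_ge_atTop _).and
        ((tendsto_rpow_atTop hν).eventually_ge_atTop _))).exists
  obtain ⟨C, hC, hCle⟩ := exists_inv_Gamma_le hM1
  have hM : 0 < M := by linarith
  refine ⟨C * z ^ (δ - 1), by positivity, fun j k => ?_⟩
  have hpos : 0 < k * θ + j * ν + δ := by positivity
  have hz' : z ^ (k * θ + j * ν + δ - 1) = (z ^ θ) ^ k * (z ^ ν) ^ j * z ^ (δ - 1) := by
    rw [← Real.rpow_natCast (z ^ θ), ← Real.rpow_natCast (z ^ ν), ← Real.rpow_mul hz.le,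
      ← Real.rpow_mul hz.le, ← Real.rpow_add hz, ← Real.rpow_add hz]
    congr 1; ring
  have hM' : M ^ (-(k * θ + j * ν + δ)) ≤ ((M ^ θ)⁻¹) ^ k * ((M ^ ν)⁻¹) ^ j := by
    rw [← Real.rpow_neg hM.le, ← Real.rpow_neg hM.le, ← Real.rpow_natCast (M ^ (-θ)),
      ← Real.rpow_natCast (M ^ (-ν)), ← Real.rpow_mul hM.le,
      ← Real.rpow_mul hM.le, ← Real.rpow_add hM]
    exact Real.rpow_le_rpow_of_exponent_le hM1 (by linarith)
  have hMθ' : B * z ^ θ * (M ^ θ)⁻¹ ≤ 2⁻¹ := by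
    rw [← div_eq_mul_inv, div_le_iff₀ (by positivity)]; linarith
  have hMν' : A * z ^ ν * (M ^ ν)⁻¹ ≤ 2⁻¹ := by
    rw [← div_eq_mul_inv, div_le_iff₀ (by positivity)]; linarith
  calc A ^ j * B ^ k * rlKernel (k * θ + j * ν + δ) z
      = A ^ j * B ^ k * ((z ^ θ) ^ k * (z ^ ν) ^ j * z ^ (δ - 1)) *
          (Real.Gamma (k * θ + j * ν + δ))⁻¹ := by rw [rlKernel, hz']; ring
    _ ≤ A ^ j * B ^ k * ((z ^ θ) ^ k * (z ^ ν) ^ j * z ^ (δ - 1)) *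
          (C * (((M ^ θ)⁻¹) ^ k * ((M ^ ν)⁻¹) ^ j)) := by
        gcongr
        exact (hCle _ hpos).trans (by gcongr)
    _ = C * z ^ (δ - 1) * ((A * z ^ ν * (M ^ ν)⁻¹) ^ j * (B * z ^ θ * (M ^ θ)⁻¹) ^ k) := by
        simp only [mul_pow]; ring
    _ ≤ _ := by gcongr

theorem rlKernel_le_mul_rlKernel {p z y : ℝ} (hp : 0 < p) (hz : 0 < z)
    (hy : y ∈ Ioo (z / 2) (2 * z)) : rlKernel p y ≤ 4 * rlKernel p (2 * z) := by
  have hy0 : 0 < y := by linarith [hy.1]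
  have hG := Real.Gamma_pos_of_pos hp
  rw [rlKernel, rlKernel, mul_div_assoc', div_le_div_iff_of_pos_right hG,
    Real.rpow_sub_one hy0.ne', Real.rpow_sub_one (by positivity), mul_div_assoc',
    div_le_div_iff₀ hy0 (by positivity)]
  have h1 : y ^ p ≤ (2 * z) ^ p := Real.rpow_le_rpow hy0.le hy.2.le hp.le
  have h2 : 2 * z ≤ 4 * y := by linarith [hy.1]
  calc y ^ p * (2 * z) ≤ (2 * z) ^ p * (4 * y) := by gcongr
    _ = _ := by ring

theorem hasDerivAt_tsum_rlKernel {ι : Type*} {d Q : ι → ℝ} (hQ : ∀ i, 0 < Q i)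
    (hd : ∀ z, 0 < z → Summable fun i => |d i| * rlKernel (Q i) z)
    (hd1 : ∀ z, 0 < z → Summable fun i => |d i| * rlKernel (Q i + 1) z) {z : ℝ} (hz : 0 < z) :
    HasDerivAt (fun z => ∑' i, d i * rlKernel (Q i + 1) z) (∑' i, d i * rlKernel (Q i) z) z := by
  have hmem : z ∈ Ioo (z / 2) (2 * z) := ⟨by linarith, by linarith⟩
  refine hasDerivAt_tsum_of_isPreconnected (g := fun i z => d i * rlKernel (Q i + 1) z)
    (g' := fun i z => d i * rlKernel (Q i) z)
    ((hd (2 * z) (by positivity)).mul_left 4) isOpen_Ioo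
    isPreconnected_Ioo (fun i y hy => ?_) (fun i y hy => ?_) hmem ?_ hmem
  · exact (hasDerivAt_rlKernel_add_one (hQ i) (by linarith [hy.1])).const_mul _
  · rw [norm_mul, Real.norm_eq_abs, Real.norm_eq_abs,
      abs_of_nonneg (rlKernel_nonneg (hQ i) (by linarith [hy.1])), mul_left_comm]
    gcongr
    exact rlKernel_le_mul_rlKernel (hQ i) hz hy
  · refine .of_norm_bounded (hd1 z hz) fun i => ?_
    rw [norm_mul, Real.norm_eq_abs, Real.norm_eq_abs,
      abs_of_nonneg (rlKernel_nonneg (by linarith [hQ i]) hz.le)]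

theorem integral_tsum_rlKernel_mul_tsum {ι κ : Type*} [Countable ι] [Countable κ]
    {e P : ι → ℝ} {d Q : κ → ℝ} (hP : ∀ i, 0 < P i) (hQ : ∀ i, 0 < Q i) {T : ℝ} (hT : 0 < T)
    (he : ∀ z, 0 < z → Summable fun i => |e i| * rlKernel (P i) z)
    (hd : ∀ z, 0 < z → Summable fun i => |d i| * rlKernel (Q i) z)
    (hed : Summable fun q : ι × κ => |e q.1 * d q.2| * rlKernel (P q.1 + Q q.2) T) :
    ∫ x in Ioc 0 T, (∑' i, e i * rlKernel (P i) (T - x)) * ∑' i, d i * rlKernel (Q i) x =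
      ∑' q : ι × κ, e q.1 * d q.2 * rlKernel (P q.1 + Q q.2) T := by
  let F : ι × κ → ℝ → ℝ := fun q x =>
    e q.1 * d q.2 * (rlKernel (P q.1) (T - x) * rlKernel (Q q.2) x)
  have hF_int : ∀ q, Integrable (F q) (volume.restrict (Ioc 0 T)) := fun q =>
    (integrableOn_rlKernel_mul (hP q.1) (hQ q.2) hT).const_mul _
  have hF_norm : ∀ q, ∫ x in Ioc 0 T, ‖F q x‖ = |e q.1 * d q.2| * rlKernel (P q.1 + Q q.2) T := by
    intro q
    rw [← integral_rlKernel_mul (hP q.1) (hQ q.2) hT, ← integral_const_mul]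
    refine setIntegral_congr_fun measurableSet_Ioc fun x hx => ?_
    simp only [F]
    rw [norm_mul, Real.norm_eq_abs, Real.norm_of_nonneg (mul_nonneg
      (rlKernel_nonneg (hP _) (sub_nonneg.2 hx.2)) (rlKernel_nonneg (hQ _) hx.1.le))]
  have hsum := hasSum_integral_of_summable_integral_norm hF_int (by simpa only [hF_norm] using hed)
  have hleft : ∀ q, ∫ x in Ioc 0 T, F q x = e q.1 * d q.2 * rlKernel (P q.1 + Q q.2) T := by
    intro q
    rw [← integral_rlKernel_mul (hP q.1) (hQ q.2) hT, ← integral_const_mul]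
  simp only [hleft] at hsum
  rw [hsum.tsum_eq, integral_Ioc_eq_integral_Ioo, integral_Ioc_eq_integral_Ioo]
  refine setIntegral_congr_fun measurableSet_Ioo fun x hx => ?_
  have h1 : Summable fun i => ‖e i * rlKernel (P i) (T - x)‖ :=
    (he _ (sub_pos.2 hx.2)).congr fun i => by
      rw [norm_mul, Real.norm_eq_abs,
        Real.norm_of_nonneg (rlKernel_nonneg (hP i) (sub_nonneg.2 hx.2.le))]
  have h2 : Summable fun i => ‖d i * rlKernel (Q i) x‖ :=
    (hd _ hx.1).congr fun i => by
      rw [norm_mul, Real.norm_eq_abs, Real.norm_of_nonneg (rlKernel_nonneg (hQ i) hx.1.le)]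
  simp only [F]
  rw [tsum_mul_tsum_of_summable_norm h1 h2]
  exact tsum_congr fun q => by ring

theorem Summable.tsum_eq_tsum_sum_antidiagonal {f : ℕ × ℕ → ℝ} (hf : Summable f) :
    ∑' p, f p = ∑' n, ∑ p ∈ Finset.HasAntidiagonal.antidiagonal n, f p := by
  have h := Finset.HasAntidiagonal.sigmaAntidiagonalEquivProd.summable_iff.2 hf
  rw [← Finset.HasAntidiagonal.sigmaAntidiagonalEquivProd.tsum_eq f]
  refine (h.tsum_sigma' fun n => (hasSum_fintype _).summable).trans (tsum_congr fun n => ?_)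
  rw [tsum_fintype]
  exact Finset.sum_coe_sort (Finset.HasAntidiagonal.antidiagonal n) f

theorem summable_abs_mul_rlKernel {ι : Type*} {J K : ι → ℕ}
    (hJK : Summable fun i => (2⁻¹ : ℝ) ^ J i * 2⁻¹ ^ K i)
    {θ ν δ A B D z : ℝ} (hθ : 0 < θ) (hν : 0 < ν) (hδ : 0 < δ)
    (hA : 0 ≤ A) (hB : 0 ≤ B) (hD : 0 ≤ D) (hz : 0 < z) {d : ι → ℝ}
    (hd : ∀ i, |d i| ≤ D * (A ^ J i * B ^ K i)) :
    Summable fun i => |d i| * rlKernel (K i * θ + J i * ν + δ) z := by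
  obtain ⟨C, -, hC⟩ := exists_mul_rlKernel_le hθ hν hδ hA hB hz
  have hK : ∀ i, 0 ≤ rlKernel (K i * θ + J i * ν + δ) z := fun i =>
    rlKernel_nonneg (by positivity) hz.le
  refine .of_nonneg_of_le (fun i => mul_nonneg (abs_nonneg _) (hK i)) (fun i => ?_)
    (hJK.mul_left (D * C))
  calc _ ≤ D * (A ^ J i * B ^ K i) * rlKernel (K i * θ + J i * ν + δ) z :=
        mul_le_mul_of_nonneg_right (hd i) (hK i)
    _ ≤ D * (C * (2⁻¹ ^ J i * 2⁻¹ ^ K i)) := by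
        rw [mul_assoc]; exact mul_le_mul_of_nonneg_left (hC _ _) hD
    _ = _ := by ring

theorem summable_inv_two_pow : Summable fun n : ℕ => (2⁻¹ : ℝ) ^ n :=
  summable_geometric_of_lt_one (by norm_num) (by norm_num)

theorem summable_inv_two_pow_mul :
    Summable fun p : ℕ × ℕ => (2⁻¹ : ℝ) ^ p.1 * 2⁻¹ ^ p.2 :=
  summable_inv_two_pow.mul_of_nonneg summable_inv_two_pow (fun _ => by positivity)
    fun _ => by positivity

theorem summable_inv_two_pow_mul_add :
    Summable fun q : ℕ × (ℕ × ℕ) => (2⁻¹ : ℝ) ^ q.2.1 * 2⁻¹ ^ (q.1 + q.2.2) :=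
  (summable_inv_two_pow.mul_of_nonneg summable_inv_two_pow_mul (fun _ => by positivity)
    fun _ => by positivity).congr fun q => by ring

theorem mittagLeffler_zero_param {θ z : ℝ} (lam : ℝ) : mittagLeffler θ 1 0 lam z = 1 := by
  rw [mittagLeffler_eq_tsum_rlKernel, tsum_eq_single 0]
  · simp [mlCoeff_zero_right, rlKernel]
  · intro k hk
    rw [mlCoeff_zero_left lam hk, zero_mul]

theorem mittagLeffler_at_zero {θ β : ℝ} (hθ : 0 < θ) (hβ : 1 < β) (r lam : ℝ) :
    mittagLeffler θ β r lam 0 = 0 := by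
  rw [mittagLeffler_eq_tsum_rlKernel]
  refine (tsum_congr fun k => ?_).trans tsum_zero
  have : (k : ℝ) * θ + β - 1 ≠ 0 := by
    have : 0 ≤ (k : ℝ) * θ := by positivity
    linarith
  rw [rlKernel, Real.zero_rpow this, zero_div, mul_zero]

/-- The coefficient of `rlKernel (k * θ + j * (1 - μ) + 1)` in the explicit solution. -/
noncomputable def solCoeff (γ lam c : ℝ) (j k : ℕ) : ℝ := c ^ j * mlCoeff (-(γ * j)) lam k

theorem exists_abs_solCoeff_le (γ lam c : ℝ) :
    ∃ A, 0 ≤ A ∧ ∀ j k, |solCoeff γ lam c j k| ≤ A ^ j * (2 * |lam|) ^ k := by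
  obtain ⟨N, hN⟩ := exists_nat_ge |γ|
  refine ⟨|c| * 2 ^ N, by positivity, fun j k => ?_⟩
  have hy : |-(γ * j)| ≤ ((N * j : ℕ) : ℝ) := by
    rw [abs_neg, abs_mul, Nat.abs_cast]
    push_cast
    gcongr
  rw [solCoeff, abs_mul, abs_pow, mul_pow, ← pow_mul, mul_assoc]
  gcongr
  exact abs_mlCoeff_le hy k

theorem tsum_mittagLeffler_eq_one_add {θ ν γ lam c z : ℝ} (hθ : 0 < θ) (hν : 0 < ν)
    (hz : 0 < z) :
    ∑' j : ℕ, c ^ j * mittagLeffler θ (j * ν + 1) (-(γ * j)) lam z =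
      1 + ∑' p : ℕ × ℕ, solCoeff γ lam c (p.1 + 1) p.2 *
        rlKernel (p.2 * θ + p.1 * ν + ν + 1) z := by
  obtain ⟨A, hA, hle⟩ := exists_abs_solCoeff_le γ lam c
  have hs : Summable fun p : ℕ × ℕ =>
      solCoeff γ lam c p.1 p.2 * rlKernel (p.2 * θ + p.1 * ν + 1) z := by
    refine Summable.of_norm_bounded (summable_abs_mul_rlKernel (J := Prod.fst) (K := Prod.snd)
      summable_inv_two_pow_mul hθ hν one_pos hA
      (B := 2 * |lam|) (by positivity) zero_le_one hz
      (d := fun p => solCoeff γ lam c p.1 p.2) fun p => by simpa using hle p.1 p.2) fun p => ?_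
    rw [norm_mul, Real.norm_eq_abs, Real.norm_of_nonneg (rlKernel_nonneg (by positivity) hz.le)]
  have hterm : ∀ j : ℕ, c ^ j * mittagLeffler θ (j * ν + 1) (-(γ * j)) lam z =
      ∑' k : ℕ, solCoeff γ lam c j k * rlKernel (k * θ + j * ν + 1) z := fun j => by
    rw [mittagLeffler_eq_tsum_rlKernel, ← tsum_mul_left]
    exact tsum_congr fun k => by rw [solCoeff, mul_assoc, add_assoc]
  have hsum : Summable fun j : ℕ => c ^ j * mittagLeffler θ (j * ν + 1) (-(γ * j)) lam z := by
    simpa only [hterm] using hs.prod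
  have hinj : Function.Injective fun p : ℕ × ℕ => (p.1 + 1, p.2) := fun p q h => by
    simpa [Prod.ext_iff] using h
  rw [hsum.tsum_eq_zero_add]
  congr 1
  · simp [mittagLeffler_zero_param]
  · have hs' := hs.comp_injective hinj
    simp only [hterm]
    have hcast : ∀ p : ℕ × ℕ, solCoeff γ lam c (p.1 + 1) p.2 *
        rlKernel (p.2 * θ + p.1 * ν + ν + 1) z = ((fun p : ℕ × ℕ =>
      solCoeff γ lam c p.1 p.2 * rlKernel (p.2 * θ + p.1 * ν + 1) z) ∘
        fun p : ℕ × ℕ => (p.1 + 1, p.2)) p := fun p => by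
      simp only [Function.comp_apply]
      congr 2
      push_cast
      ring
    simp only [hcast]
    rw [hs'.tsum_prod]
    rfl

theorem tsum_mlCoeff_mul_solCoeff {θ ν γ lam c z : ℝ}
    (hs : Summable fun q : ℕ × (ℕ × ℕ) => mlCoeff γ lam q.1 * solCoeff γ lam c (q.2.1 + 1) q.2.2 *
      rlKernel (((q.1 + q.2.2 : ℕ) : ℝ) * θ + q.2.1 * ν + 1) z) :
    ∑' q : ℕ × (ℕ × ℕ), mlCoeff γ lam q.1 * solCoeff γ lam c (q.2.1 + 1) q.2.2 *
        rlKernel (((q.1 + q.2.2 : ℕ) : ℝ) * θ + q.2.1 * ν + 1) z =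
      c * ∑' j : ℕ, c ^ j * mittagLeffler θ (j * ν + 1) (-(γ * j)) lam z := by
  let σ : ℕ × (ℕ × ℕ) ≃ ℕ × (ℕ × ℕ) :=
    { toFun := fun q => (q.2.1, (q.1, q.2.2))
      invFun := fun q => (q.2.1, (q.1, q.2.2))
      left_inv := fun _ => rfl
      right_inv := fun _ => rfl }
  have hs' := σ.summable_iff.2 hs
  rw [← σ.tsum_eq, ← tsum_mul_left]
  refine hs'.tsum_prod.trans (tsum_congr fun j => ?_)
  refine (hs'.prod_factor j).tsum_eq_tsum_sum_antidiagonal.trans ?_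
  rw [mittagLeffler_eq_tsum_rlKernel, ← tsum_mul_left, ← tsum_mul_left]
  refine tsum_congr fun n => ?_
  have hγ : -(γ * j) = γ + -(γ * (j + 1 : ℕ)) := by push_cast; ring
  rw [hγ, ← sum_antidiagonal_mlCoeff, Finset.sum_mul, Finset.mul_sum, Finset.mul_sum]
  refine Finset.sum_congr rfl fun p hp => ?_
  rw [← Finset.HasAntidiagonal.mem_antidiagonal.1 hp]
  simp only [Function.comp_apply, σ, Equiv.coe_fn_mk, solCoeff, ← add_assoc]
  ring

theorem summable_abs_solCoeff_succ_mul_rlKernel {θ ν δ z : ℝ} (γ lam c : ℝ) (hθ : 0 < θ)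
    (hν : 0 < ν) (hδ : 0 < δ) (hz : 0 < z) :
    Summable fun p : ℕ × ℕ =>
      |solCoeff γ lam c (p.1 + 1) p.2| * rlKernel (p.2 * θ + p.1 * ν + δ) z := by
  obtain ⟨A, hA, hle⟩ := exists_abs_solCoeff_le γ lam c
  refine summable_abs_mul_rlKernel (J := Prod.fst) (K := Prod.snd) summable_inv_two_pow_mul
    hθ hν hδ hA (B := 2 * |lam|) (by positivity) hA hz fun p => (hle _ _).trans_eq ?_
  ring

theorem summable_abs_mlCoeff_mul_rlKernel {θ δ z : ℝ} (γ lam : ℝ) (hθ : 0 < θ) (hδ : 0 < δ)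
    (hz : 0 < z) : Summable fun k : ℕ => |mlCoeff γ lam k| * rlKernel (k * θ + δ) z := by
  obtain ⟨N, hN⟩ := exists_nat_ge |γ|
  have h := summable_abs_mul_rlKernel (J := fun _ => 0) (K := fun k : ℕ => k)
    (by simpa using summable_inv_two_pow) hθ one_pos hδ zero_le_one
    (B := 2 * |lam|) (by positivity) (D := 2 ^ N) (by positivity) hz (d := mlCoeff γ lam)
    fun k => by simpa using abs_mlCoeff_le hN k
  simpa using h

theorem summable_abs_mlCoeff_mul_solCoeff_mul_rlKernel {θ ν δ z : ℝ} (γ lam c : ℝ) (hθ : 0 < θ)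
    (hν : 0 < ν) (hδ : 0 < δ) (hz : 0 < z) :
    Summable fun q : ℕ × (ℕ × ℕ) => |mlCoeff γ lam q.1 * solCoeff γ lam c (q.2.1 + 1) q.2.2| *
      rlKernel (((q.1 + q.2.2 : ℕ) : ℝ) * θ + q.2.1 * ν + δ) z := by
  obtain ⟨A, hA, hle⟩ := exists_abs_solCoeff_le γ lam c
  obtain ⟨N, hN⟩ := exists_nat_ge |γ|
  refine summable_abs_mul_rlKernel (J := fun q : ℕ × (ℕ × ℕ) => q.2.1)
    (K := fun q : ℕ × (ℕ × ℕ) => q.1 + q.2.2) summable_inv_two_pow_mul_add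
    hθ hν hδ hA (B := 2 * |lam|) (by positivity) (D := 2 ^ N * A) (by positivity) hz fun q => ?_
  rw [abs_mul]
  calc _ ≤ 2 ^ N * (2 * |lam|) ^ q.1 * (A ^ (q.2.1 + 1) * (2 * |lam|) ^ q.2.2) := by
        gcongr
        · exact abs_mlCoeff_le hN _
        · exact hle _ _
    _ = _ := by ring

theorem integral_mittagLeffler_mul_tsum {θ μ γ lam c T : ℝ} (hθ : 0 < θ) (hμ0 : 0 < μ)
    (hμ1 : μ < 1) (hT : 0 < T) :
    ∫ x in Ioc 0 T, mittagLeffler θ μ γ lam (T - x) *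
        ∑' p : ℕ × ℕ, solCoeff γ lam c (p.1 + 1) p.2 *
          rlKernel (p.2 * θ + p.1 * (1 - μ) + (1 - μ)) x =
      c * ∑' j : ℕ, c ^ j * mittagLeffler θ (j * (1 - μ) + 1) (-(γ * j)) lam T := by
  have hν : 0 < 1 - μ := sub_pos.2 hμ1
  have hs := summable_abs_mlCoeff_mul_solCoeff_mul_rlKernel γ lam c hθ hν one_pos hT
  have hexp : ∀ q : ℕ × (ℕ × ℕ), ((q.1 + q.2.2 : ℕ) : ℝ) * θ + q.2.1 * (1 - μ) + 1 =
      q.1 * θ + μ + (q.2.2 * θ + q.2.1 * (1 - μ) + (1 - μ)) := fun q => by push_cast; ring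
  rw [← tsum_mlCoeff_mul_solCoeff (.of_norm_bounded hs fun q => ?_)]
  · simp only [hexp] at hs ⊢
    simp only [mittagLeffler_eq_tsum_rlKernel]
    exact integral_tsum_rlKernel_mul_tsum (P := fun k : ℕ => k * θ + μ)
      (Q := fun p : ℕ × ℕ => p.2 * θ + p.1 * (1 - μ) + (1 - μ))
      (d := fun p : ℕ × ℕ => solCoeff γ lam c (p.1 + 1) p.2)
      (fun _ => by positivity) (fun _ => by positivity) hT
      (fun z hz => summable_abs_mlCoeff_mul_rlKernel γ lam hθ hμ0 hz)
      (fun z hz => summable_abs_solCoeff_succ_mul_rlKernel γ lam c hθ hν hν hz) hs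
  · rw [norm_mul, Real.norm_eq_abs, Real.norm_of_nonneg (rlKernel_nonneg (by positivity) hT.le)]

/-- Explicit solution of the homogeneous linear generalized ABC equation. -/
theorem linear_abc_homogeneous_solution
    (θ μ γ b ρ a0 t0 : ℝ) (hθ0 : 0 < θ) (hθ1 : θ < 1)
    (hμ0 : 0 < μ) (hμ1 : μ < 1) (hγ : 0 < γ) (hb : 0 < b)
    (α : ℝ → ℝ)
    (hα : ∀ t, α t = a0 * ∑' j : ℕ, ρ ^ j * ((1 - θ) / b) ^ j *
      mittagLeffler θ ((j : ℝ) * (1 - μ) + 1) (-(γ * (j : ℝ))) (-θ / (1 - θ)) (t - t0)) :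
    α t0 = a0 ∧ ∀ t, t0 < t → ABCDeriv t0 b θ μ γ α t = ρ * α t := by
  have hν : 0 < 1 - μ := sub_pos.2 hμ1
  have hθ' : 1 - θ ≠ 0 := (sub_pos.2 hθ1).ne'
  simp only [← mul_pow] at hα
  set lam := -θ / (1 - θ) with hlam
  set c := ρ * ((1 - θ) / b) with hc
  refine ⟨?_, fun t ht => ?_⟩
  · rw [hα, sub_self, tsum_eq_single 0]
    · simp [mittagLeffler_zero_param]
    · intro j hj
      have : 0 < (j : ℝ) * (1 - μ) := mul_pos (by exact_mod_cast Nat.pos_of_ne_zero hj) hν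
      rw [mittagLeffler_at_zero hθ0 (by linarith), mul_zero]
  · have hderiv : ∀ x, 0 < x → deriv α (x + t0) =
        a0 * ∑' p : ℕ × ℕ, solCoeff γ lam c (p.1 + 1) p.2 *
          rlKernel (p.2 * θ + p.1 * (1 - μ) + (1 - μ)) x := by
      intro x hx
      have h := hasDerivAt_tsum_rlKernel (Q := fun p : ℕ × ℕ => p.2 * θ + p.1 * (1 - μ) + (1 - μ))
        (d := fun p : ℕ × ℕ => solCoeff γ lam c (p.1 + 1) p.2) (fun _ => by positivity)
        (fun z hz => summable_abs_solCoeff_succ_mul_rlKernel γ lam c hθ0 hν hν hz)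
        (fun z hz => by
          simpa only [add_assoc] using summable_abs_solCoeff_succ_mul_rlKernel γ lam c hθ0 hν
            (add_pos hν one_pos) hz) hx
      have h2 := ((h.const_add 1).const_mul a0)
      rw [← add_sub_cancel_right x t0] at h2
      have h3 := HasDerivAt.comp_sub_const (x + t0) t0 h2
      rw [add_sub_cancel_right] at h3
      refine (h3.congr_of_eventuallyEq ?_).deriv
      filter_upwards [lt_mem_nhds (lt_add_of_pos_left t0 hx)] with y hy
      rw [hα, tsum_mittagLeffler_eq_one_add hθ0 hν (sub_pos.2 hy)]
    have hint : ∫ s in t0..t, mittagLeffler θ μ γ lam (t - s) * deriv α s =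
        a0 * (c * ∑' j : ℕ, c ^ j *
          mittagLeffler θ (j * (1 - μ) + 1) (-(γ * j)) lam (t - t0)) := by
      rw [← integral_mittagLeffler_mul_tsum hθ0 hμ0 hμ1 (sub_pos.2 ht), ← integral_const_mul]
      have hshift := intervalIntegral.integral_comp_add_right (a := 0) (b := t - t0)
        (fun s => mittagLeffler θ μ γ lam (t - s) * deriv α s) t0
      rw [zero_add, sub_add_cancel] at hshift
      rw [← hshift, intervalIntegral.integral_of_le (sub_pos.2 ht).le]
      refine setIntegral_congr_fun measurableSet_Ioc fun x hx => ?_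
      simp only [hderiv x hx.1, ← sub_sub, sub_right_comm t x t0]
      exact mul_left_comm _ _ _
    have hbc : b / (1 - θ) * c = ρ := by
      rw [hc]
      field_simp
    rw [ABCDeriv, ← hlam, hint, ← mul_left_comm c, ← hα, ← mul_assoc, hbc]
end
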